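/- arXiv:2602.22876 — 10 statements merged into one kernel-verified Lean document; each statement's English description precedes it below -/
import Mathlib

section
/- Every infinite group is unstable. Precisely: for every infinite group G there exist a non-empty subset A ⊆ G and two subsets U, V ⊆ G, each of which is a right s-factor of G associated with A, such that the cardinality of U differs from the cardinality of V. -/
open Pointwise

/-- The (left) Cayley graph of `G` with connection set `S`:
distinct `g, h` are adjacent iff `g * h⁻¹ ∈ S` (for symmetric `S`). -/
def cayley (G : Type*) [Group G] (S : Set G) : SimpleGraph G :=
  SimpleGraph.fromRel (fun g h => g * h⁻¹ ∈ S)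

/-- The graph `Δ(F)` on vertex set `F`: distinct `u, v ∈ F` are adjacent
iff `u * v⁻¹ ∈ F` (for symmetric `F`). -/
def delta {G : Type*} [Group G] (F : Set G) : SimpleGraph F :=
  SimpleGraph.fromRel (fun u v => (u : G) * (v : G)⁻¹ ∈ F)

/-- Condition (SF1): the product `A * U` is direct. -/
def SF1 {G : Type*} [Group G] (A U : Set G) : Prop :=
  ∀ a ∈ A, ∀ b ∈ A, ∀ u ∈ U, ∀ v ∈ U, a * u = b * v → a = b ∧ u = v

/-- `U` is a right s-factor of `G` associated with `A`: `U` satisfies (SF1) for `A`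
and is maximal with respect to inclusion among subsets satisfying (SF1) for `A`. -/
def IsRightSFactor {G : Type*} [Group G] (A U : Set G) : Prop :=
  SF1 A U ∧ ∀ W : Set G, SF1 A W → U ⊆ W → W = U

/-- `s` is an independent set of vertices of `Γ`. -/
def IsIndep {V : Type*} (Γ : SimpleGraph V) (s : Set V) : Prop :=
  ∀ u ∈ s, ∀ v ∈ s, ¬ Γ.Adj u v

/-- `s` is a maximal independent set of `Γ`. -/
def IsMaxIndep {V : Type*} (Γ : SimpleGraph V) (s : Set V) : Prop :=
  IsIndep Γ s ∧ ∀ t : Set V, IsIndep Γ t → s ⊆ t → t = s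

/-- `s` is a maximal clique of `Γ`. -/
def IsMaxClique {V : Type*} (Γ : SimpleGraph V) (s : Set V) : Prop :=
  Γ.IsClique s ∧ ∀ t : Set V, Γ.IsClique t → s ⊆ t → t = s

/-- A graph is well-covered if all its maximal independent sets have the same cardinality. -/
def WellCovered {V : Type*} (Γ : SimpleGraph V) : Prop :=
  ∀ s t : Set V, IsMaxIndep Γ s → IsMaxIndep Γ t → Cardinal.mk s = Cardinal.mk t

/-- On an infinite type one can choose values one after the other so that each choice avoids
finitely many values prescribed by each earlier choice. -/
theorem exists_fun_avoiding {α κ : Type*} [Infinite α] [Finite κ] (S : α → α → α → κ → α) :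
    ∃ f : α → α, ∀ g h, g ≠ h →
      (∀ k, f g ≠ S g h (f h) k) ∨ (∀ k, f h ≠ S h g (f g) k) := by
  obtain ⟨r, wo, hr⟩ := Cardinal.exists_ord_eq α
  have hex : ∀ (g : α) (f : ∀ h, r h g → α), ∃ y, ∀ h (hh : r h g) k, y ≠ S g h (f h hh) k := by
    intro g f
    by_contra! hcon
    choose h hh k hk using hcon
    have hinj : Function.Injective fun y => ((⟨h y, hh y⟩, k y) : {h // r h g} × κ) := by
      intro x y hxy
      simp only [Prod.mk.injEq, Subtype.mk.injEq] at hxy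
      obtain ⟨h1, h2⟩ := hxy
      rw [hk x, hk y]
      congr!
    have hlt : Cardinal.mk {h // r h g} < Cardinal.mk α := Cardinal.card_typein_lt g hr
    have hκ : Cardinal.mk κ < Cardinal.aleph0 := Cardinal.lt_aleph0_of_finite κ
    have := Cardinal.lift_mk_le_lift_mk_of_injective hinj
    simp only [Cardinal.mk_prod, Cardinal.lift_mul, Cardinal.lift_lift] at this
    refine this.not_gt (Cardinal.mul_lt_of_lt ?_ ?_ ?_)
    · simp
    · simpa using hlt
    · refine lt_of_lt_of_le (Cardinal.lift_lt_aleph0.2 hκ) ?_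
      simp
  choose F hF using hex
  let f : α → α := wo.wf.fix F
  have hf : ∀ g h, r h g → ∀ k, f g ≠ S g h (f h) k := by
    intro g h hh k
    have : f g = F g fun h _ => f h := wo.wf.fix_eq F g
    rw [this]
    exact hF g (fun h _ => f h) h hh k
  refine ⟨f, fun g h hne => ?_⟩
  rcases trichotomous_of r g h with hgh | hgh | hgh
  · exact Or.inr (hf h g hgh)
  · exact absurd hgh hne
  · exact Or.inl (hf g h hgh)

/-- In an infinite group, every finite symmetric set containing `1` is, up to `1`, the complement
of the set of quotients `a⁻¹ * b` of some set `A`. -/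
theorem exists_set_quotients_eq_compl {G : Type*} [Group G] [Infinite G] {E : Set G}
    (hfin : E.Finite) (hinv : ∀ x ∈ E, x⁻¹ ∈ E) :
    ∃ A : Set G, (∀ g ∉ E, ∃ a ∈ A, ∃ b ∈ A, a⁻¹ * b = g) ∧
      ∀ a ∈ A, ∀ b ∈ A, a⁻¹ * b ∈ E → a = b := by
  have := hfin.to_subtype
  obtain ⟨f, hf⟩ := exists_fun_avoiding (κ := E × Bool × Bool) fun (g h y : G) k =>
    (y * if k.2.1 then h else 1) * k.1 * (if k.2.2 then g else 1)⁻¹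
  have key : ∀ g h, (∀ k : E × Bool × Bool,
      f g ≠ (f h * if k.2.1 then h else 1) * k.1 * (if k.2.2 then g else 1)⁻¹) →
      ∀ s t : Bool, (f h * if s then h else 1)⁻¹ * (f g * if t then g else 1) ∉ E := by
    intro g h H s t hE
    refine H (⟨_, hE⟩, s, t) ?_
    cases t <;> simp [mul_assoc]
  refine ⟨{x | ∃ g ∉ E, ∃ s : Bool, x = f g * if s then g else 1}, fun g hg => ?_, ?_⟩
  · exact ⟨f g, ⟨g, hg, false, by simp⟩, f g * g, ⟨g, hg, true, by simp⟩, by simp⟩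
  · rintro _ ⟨g, hg, s, rfl⟩ _ ⟨h, hh, t, rfl⟩ hE
    by_cases hgh : g = h
    · subst hgh
      cases s <;> cases t <;> simp at hE ⊢
      · exact absurd hE hg
      · exact absurd (by simpa using hinv _ hE) hg
    · rcases hf g h hgh with H | H
      · exact absurd (by simpa only [mul_inv_rev, inv_inv] using hinv _ hE) (key g h H t s)
      · exact absurd hE (key h g H s t)

theorem sf1_iff_of_quotients_eq_compl {G : Type*} [Group G] {A E : Set G} (h1 : (1 : G) ∈ E)
    (hA : ∀ g ∉ E, ∃ a ∈ A, ∃ b ∈ A, a⁻¹ * b = g)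
    (hE : ∀ a ∈ A, ∀ b ∈ A, a⁻¹ * b ∈ E → a = b) (U : Set G) :
    SF1 A U ↔ ∀ u ∈ U, ∀ v ∈ U, u * v⁻¹ ∈ E := by
  constructor
  · intro H u hu v hv
    by_contra hn
    obtain ⟨a, ha, b, hb, hab⟩ := hA _ hn
    have : a * u = b * v := by
      rw [inv_mul_eq_iff_eq_mul] at hab
      simp [hab, mul_assoc]
    obtain ⟨-, rfl⟩ := H a ha b hb u hu v hv this
    simp [h1] at hn
  · intro H a ha b hb u hu v hv huv
    have hab : a = b := by
      refine hE a ha b hb ?_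
      have : a⁻¹ * b = u * v⁻¹ := by
        rw [inv_mul_eq_iff_eq_mul, ← mul_assoc, huv]
        simp
      exact this ▸ H u hu v hv
    subst hab
    exact ⟨rfl, mul_left_cancel huv⟩

theorem SF1.exists_isRightSFactor_superset {G : Type*} [Group G] {A K : Set G} (hK : SF1 A K) :
    ∃ U, K ⊆ U ∧ IsRightSFactor A U := by
  obtain ⟨U, hKU, hU⟩ := zorn_subset_nonempty {U | SF1 A U} (fun c hc hchain _ => by
    refine ⟨⋃₀ c, ?_, fun s hs => Set.subset_sUnion_of_mem hs⟩
    rintro a ha b hb u ⟨s, hs, hu⟩ v ⟨t, ht, hv⟩ huv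
    rcases hchain.total hs ht with hst | hst
    · exact hc ht a ha b hb u (hst hu) v hv huv
    · exact hc hs a ha b hb u hu v (hst hv) huv) K hK
  exact ⟨U, hKU, hU.prop, fun W hW hUW => (hU.eq_of_subset hW hUW).symm⟩

/-- Every infinite group is unstable: there is a non-empty subset `A` with two
right s-factors of different cardinalities. -/
theorem every_infinite_group_unstable (G : Type*) [Group G] [Infinite G] :
    ∃ A : Set G, A.Nonempty ∧ ∃ U V : Set G,
      IsRightSFactor A U ∧ IsRightSFactor A V ∧ Cardinal.mk U ≠ Cardinal.mk V := by
  classical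
  obtain ⟨K, hK⟩ := Infinite.exists_subset_card_eq G 5
  obtain ⟨k, hk⟩ : K.Nonempty := Finset.card_pos.1 (by omega)
  set P : Finset G := K * K⁻¹ with hP
  have hP1 : (1 : G) ∈ P := Finset.mem_mul.2 ⟨k, hk, k⁻¹, Finset.inv_mem_inv hk, by simp⟩
  have hPinv : ∀ x ∈ P, x⁻¹ ∈ P := by
    intro x hx
    have : P⁻¹ = P := by simp [hP]
    rw [← this]
    exact Finset.inv_mem_inv hx
  obtain ⟨z, hz⟩ := Infinite.exists_notMem_finset (P * P)
  set E : Finset G := P ∪ {z, z⁻¹} with hEdef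
  have hE1 : (1 : G) ∈ E := Finset.mem_union_left _ hP1
  have hEinv : ∀ x ∈ E, x⁻¹ ∈ E := by
    intro x hx
    simp only [hEdef, Finset.mem_union, Finset.mem_insert, Finset.mem_singleton] at hx ⊢
    rcases hx with hx | rfl | rfl
    · exact Or.inl (hPinv x hx)
    · simp
    · simp
  obtain ⟨A, hA, hAE⟩ := exists_set_quotients_eq_compl (E := (E : Set G)) E.finite_toSet
    (by simpa using hEinv)
  have hsf := sf1_iff_of_quotients_eq_compl (by simpa using hE1) hA hAE
  have hAne : A.Nonempty := by
    obtain ⟨g, hg⟩ := Infinite.exists_notMem_finset E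
    obtain ⟨a, ha, -⟩ := hA g (by simpa using hg)
    exact ⟨a, ha⟩
  have hKsf : SF1 A (K : Set G) := (hsf _).2 fun u hu v hv =>
    Finset.mem_coe.2 (Finset.mem_union_left _ (Finset.mul_mem_mul hu (Finset.inv_mem_inv hv)))
  have hzsf : SF1 A ({1, z} : Set G) := (hsf _).2 (by
    rintro u (rfl | rfl) v (rfl | rfl) <;> simp [hEdef, hP1])
  obtain ⟨U, hKU, hU⟩ := hKsf.exists_isRightSFactor_superset
  obtain ⟨V, hzV, hV⟩ := hzsf.exists_isRightSFactor_superset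
  have hVsub : V ⊆ (({1, z, z⁻¹, z * z} : Finset G) : Set G) := by
    intro u hu
    have h1 := (hsf V).1 hV.1 u hu 1 (hzV (by simp))
    have h2 := (hsf V).1 hV.1 z (hzV (by simp)) u hu
    simp only [hEdef, Finset.coe_union, Finset.coe_insert, Finset.coe_singleton, Set.mem_union,
      Finset.mem_coe, Set.mem_insert_iff, Set.mem_singleton_iff, inv_one, mul_one] at h1 h2 ⊢
    rcases h1 with h1 | h1 | h1
    · rcases h2 with h2 | h2 | h2
      · exact absurd (Finset.mem_mul.2 ⟨_, h2, u, h1, by simp⟩) hz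
      · simp at h2
        simp [h2]
      · right; right; right
        rw [mul_inv_eq_iff_eq_mul, eq_inv_mul_iff_mul_eq] at h2
        exact h2.symm
    · simp [h1]
    · simp [h1]
  have hVle : Cardinal.mk V ≤ 4 := by
    refine (Cardinal.mk_le_mk_of_subset hVsub).trans ?_
    rw [Finset.coe_sort_coe, Cardinal.mk_coe_finset]
    exact_mod_cast Finset.card_le_four
  have hUge : 5 ≤ Cardinal.mk U := by
    refine le_trans ?_ (Cardinal.mk_le_mk_of_subset hKU)
    rw [Finset.coe_sort_coe, Cardinal.mk_coe_finset, hK]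
    norm_num
  refine ⟨A, hAne, U, V, hU, hV, fun h => ?_⟩
  have : (5 : Cardinal) ≤ 4 := hUge.trans (h ▸ hVle)
  exact absurd this (by norm_num)
end

section
/- For every infinite group G there exists a finite symmetric subset F ⊆ G with 1 ∉ F such that the graph Δ(F) has a maximal clique Q₁ and a clique Q₂ with |Q₁| < |Q₂|; in particular, not all maximal cliques of Δ(F) have the same cardinality. -/
open Pointwise

/-- If `F` is the union of `E` and a generic pair `g, g⁻¹`, then the only possible neighbours of `g`
in `Δ(F)` are `g⁻¹` and `g ^ 2`. -/
theorem eq_of_delta_adj {G : Type*} [Group G] {E F : Set G} {g : G}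
    (hF : F = E ∪ {g, g⁻¹}) (hsymm : F⁻¹ = F) (h_one : (1 : G) ∉ F) (hg : g ∉ E * E)
    {u v : F} (hu : (u : G) = g) (huv : (delta F).Adj u v) :
    (v : G) = g⁻¹ ∨ (v : G) = g ^ 2 := by
  obtain ⟨hne, h⟩ := huv
  have hmem : g * (v : G)⁻¹ ∈ F := by
    rcases h with h | h
    · rwa [hu] at h
    · have h' := Set.inv_mem_inv.2 h
      rw [hsymm] at h'
      simpa [hu] using h'
  have hvg : (v : G) ≠ g := fun h => hne (Subtype.ext (hu.trans h.symm))
  have hv := v.2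
  have hv_one : (v : G) ≠ 1 := fun h => h_one (h ▸ hv)
  have hmem' : g * (v : G)⁻¹ ∈ E ∪ {g, g⁻¹} := hF ▸ hmem
  rcases hmem' with h | h | h
  · have hv' : (v : G) ∈ E ∪ {g, g⁻¹} := hF ▸ hv
    rcases hv' with h' | h' | h'
    · exact absurd ⟨_, h, _, h', by simp⟩ hg
    · exact absurd h' hvg
    · exact Or.inl h'
  · exact absurd (by simpa using h) hv_one
  · right
    have h : g * (v : G)⁻¹ = g⁻¹ := h
    rw [mul_inv_eq_iff_eq_mul] at h
    rw [pow_two]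
    nth_rewrite 2 [h]
    simp

/-- In a finite graph every clique is contained in a maximal clique. -/
theorem exists_isMaxClique_superset {V : Type*} [Finite V] (Γ : SimpleGraph V) {s : Set V}
    (hs : Γ.IsClique s) : ∃ t, s ⊆ t ∧ IsMaxClique Γ t := by
  obtain ⟨t, hst, ht⟩ := Finite.exists_le_maximal (p := fun t : Set V => Γ.IsClique t) hs
  exact ⟨t, hst, ht.prop, fun r hr htr => (ht.le_of_ge hr htr).antisymm htr⟩

/-- For every infinite group there is a finite symmetric subset `F` with `1 ∉ F`
such that `Δ(F)` has a maximal clique strictly smaller than some clique. -/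
theorem exists_finite_symmetric_set_with_unequal_maximal_cliques
    (G : Type*) [Group G] [Infinite G] :
    ∃ F : Set G, F.Finite ∧ F⁻¹ = F ∧ (1 : G) ∉ F ∧
      ∃ Q₁ Q₂ : Set F, IsMaxClique (delta F) Q₁ ∧ (delta F).IsClique Q₂ ∧
        Cardinal.mk Q₁ < Cardinal.mk Q₂ := by
  classical
  obtain ⟨B, hB, hBcard⟩ :=
    (Set.Finite.infinite_compl (Set.finite_singleton (1 : G))).exists_subset_card_eq 4
  have hB_one : (1 : G) ∉ B := fun h => hB h rfl
  set A : Set G := insert 1 (B : Set G)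
  have hAfin : A.Finite := B.finite_toSet.insert 1
  set E : Set G := (A / A) \ {1} with hE
  have hEfin : E.Finite := (hAfin.div hAfin).sdiff
  obtain ⟨g, hg⟩ := ((hEfin.mul hEfin).union (Set.finite_singleton 1)).infinite_compl.nonempty
  rw [Set.mem_compl_iff, Set.mem_union, not_or] at hg
  obtain ⟨hgE, hg_one⟩ := hg
  rw [Set.mem_singleton_iff] at hg_one
  have hEsymm : E⁻¹ = E := by
    rw [hE, Set.sdiff_eq, Set.inter_inv, Set.compl_inv, inv_div]
    simp
  obtain ⟨F, hF⟩ : ∃ F : Set G, F = E ∪ {g, g⁻¹} := ⟨_, rfl⟩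
  have hFfin : F.Finite := hF ▸ hEfin.union (Set.toFinite _)
  have hsymm : F⁻¹ = F := by
    rw [hF, Set.union_inv, hEsymm]
    simp [Set.inv_insert, Set.pair_comm]
  have h_one : (1 : G) ∉ F := by
    rw [hF]
    simp [hE, hg_one, eq_comm]
  have hgF : g ∈ F := by simp [hF]
  have hdiv : ∀ a ∈ A, ∀ b ∈ A, a ≠ b → a / b ∈ F := fun a ha b hb hab => by
    rw [hF]
    exact Or.inl ⟨Set.div_mem_div ha hb, fun h => hab (div_eq_one.1 h)⟩
  have : Finite F := hFfin
  obtain ⟨Q, hgQ, hQ⟩ := exists_isMaxClique_superset (delta F)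
    (SimpleGraph.isClique_singleton (G := delta F) ⟨g, hgF⟩)
  refine ⟨F, hFfin, hsymm, h_one, Q, Subtype.val ⁻¹' (B : Set G), hQ, ?_, ?_⟩
  · intro u hu v hv huv
    refine ⟨huv, Or.inl ?_⟩
    change (u : G) * (v : G)⁻¹ ∈ F
    rw [← div_eq_mul_inv]
    exact hdiv _ (Or.inr hu) _ (Or.inr hv) (fun h => huv (Subtype.ext h))
  · have hBF : (B : Set G) ⊆ F := fun b hb => by
      simpa using hdiv b (Or.inr hb) 1 (Or.inl rfl) (fun h => hB_one (h ▸ hb))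
    have hQsub : Subtype.val '' Q ⊆ (({g, g⁻¹, g ^ 2} : Finset G) : Set G) := by
      rintro _ ⟨v, hv, rfl⟩
      by_cases hvg : (v : G) = g
      · simp [hvg]
      · have hadj := hQ.1 (hgQ rfl) hv (fun h => hvg (congrArg Subtype.val h).symm)
        rcases eq_of_delta_adj hF hsymm h_one hgE rfl hadj with h | h <;> simp [h]
    rw [← Cardinal.mk_image_eq (s := Q) Subtype.val_injective,
      ← Cardinal.mk_image_eq (s := Subtype.val ⁻¹' (B : Set G)) Subtype.val_injective,
      Subtype.image_preimage_coe, Set.inter_eq_right.2 hBF]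
    refine (Cardinal.mk_le_mk_of_subset hQsub).trans_lt ?_
    rw [Finset.coe_sort_coe, Finset.coe_sort_coe, Cardinal.mk_coe_finset, Cardinal.mk_coe_finset,
      hBcard]
    exact_mod_cast Nat.lt_succ_of_le Finset.card_le_three
end

section
/- Let G be a group and A ⊆ G a non-empty subset. A subset U ⊆ G is a right s-factor of G associated with A if and only if U is a maximal independent set of the Cayley graph Cay(G, ∂A). -/
open Pointwise

/-- The product `A * U` is direct iff `U` is an independent set of `Cay(G, ∂A)`. -/
theorem sf1_iff_isIndep {G : Type*} [Group G] (A U : Set G) :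
    SF1 A U ↔ IsIndep (cayley G ((A⁻¹ * A) \ {1})) U := by
  have not_adj : SF1 A U → ∀ u ∈ U, ∀ v ∈ U, u ≠ v → u * v⁻¹ ∉ A⁻¹ * A := by
    rintro h u hu v hv huv ⟨a, ha, b, hb, hab⟩
    refine huv (h a⁻¹ ha b hb u hu v hv ?_).2
    rw [inv_mul_eq_iff_eq_mul, ← mul_assoc]
    exact mul_inv_eq_iff_eq_mul.mp hab.symm
  constructor
  · intro h u hu v hv hadj
    obtain ⟨huv, hmem | hmem⟩ := (SimpleGraph.fromRel_adj _ _ _).mp hadj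
    · exact not_adj h u hu v hv huv hmem.1
    · exact not_adj h v hv u hu huv.symm hmem.1
  · intro h a ha b hb u hu v hv huv
    have hquot : a⁻¹ * b = u * v⁻¹ := by
      rw [inv_mul_eq_iff_eq_mul, ← mul_assoc, huv, mul_inv_cancel_right]
    have heq : u = v := by
      by_contra hne
      refine h u hu v hv ((SimpleGraph.fromRel_adj _ _ _).mpr ⟨hne, Or.inl ⟨?_, ?_⟩⟩)
      · exact hquot ▸ Set.mul_mem_mul (Set.inv_mem_inv.mpr ha) hb
      · exact fun hone => hne (mul_inv_eq_one.mp hone)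
    exact ⟨mul_right_cancel (heq ▸ huv), heq⟩

/-- `U` is a right s-factor associated with a non-empty `A` iff `U` is a maximal
independent set of `Cay(G, ∂A)`. -/
theorem rightSFactor_iff_maxIndep (G : Type*) [Group G] (A : Set G) (hA : A.Nonempty)
    (U : Set G) :
    IsRightSFactor A U ↔ IsMaxIndep (cayley G ((A⁻¹ * A) \ {1})) U := by
  simp only [IsRightSFactor, IsMaxIndep, sf1_iff_isIndep]
end

section
/- Let G be a group, A ⊆ G a subset with 1 ∈ A, and suppose F = G \ (A⁻¹A) is finite. Then the Cayley graph Cay(G, ∂A) is well-covered if and only if all maximal cliques of Δ(F) have the same cardinality. -/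
open Pointwise

section DeltaCliques

variable {G : Type*} [Group G]

/-- The set `{1} ∪ Q` of elements of `G` obtained from a set `Q` of vertices of `Δ(F)`. -/
def insertOne {F : Set G} (Q : Set F) : Set G := insert 1 (Subtype.val '' Q)

theorem mk_insertOne {F : Set G} (h1 : (1 : G) ∉ F) (Q : Set F) :
    Cardinal.mk (insertOne Q) = Cardinal.mk Q + 1 := by
  rw [insertOne, Cardinal.mk_insert, Cardinal.mk_image_eq Subtype.val_injective]
  rintro ⟨x, -, hx⟩
  exact h1 (hx ▸ x.2)

theorem preimage_val_insertOne {F : Set G} (h1 : (1 : G) ∉ F) (Q : Set F) :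
    (Subtype.val ⁻¹' insertOne Q : Set F) = Q := by
  ext x
  have hx : (x : G) ≠ 1 := fun h => h1 (h ▸ x.2)
  simp [insertOne, hx]

theorem insertOne_preimage_val {F s : Set G} (h1 : (1 : G) ∈ s)
    (hs : s.Pairwise fun u v => u * v⁻¹ ∈ F) :
    insertOne (Subtype.val ⁻¹' s : Set F) = s := by
  ext x
  simp only [insertOne, Set.mem_insert_iff, Set.mem_image, Set.mem_preimage]
  constructor
  · rintro (rfl | ⟨y, hy, rfl⟩)
    exacts [h1, hy]
  · intro hx
    by_cases hx1 : x = 1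
    · exact Or.inl hx1
    · exact Or.inr ⟨⟨x, by simpa using hs hx h1 hx1⟩, hx, rfl⟩

theorem insertOne_mono {F : Set G} {P Q : Set F} (h : P ⊆ Q) : insertOne P ⊆ insertOne Q :=
  Set.insert_subset_insert (Set.image_mono h)

theorem isClique_delta_iff {F : Set G} (hF : ∀ x ∈ F, x⁻¹ ∈ F) (Q : Set F) :
    (delta F).IsClique Q ↔ (insertOne Q).Pairwise fun u v => u * v⁻¹ ∈ F := by
  have hsymm : Std.Symm fun u v : G => u * v⁻¹ ∈ F :=
    ⟨fun u v h => by simpa using hF _ h⟩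
  rw [insertOne, Set.pairwise_insert_of_symm]
  constructor
  · intro h
    refine ⟨?_, ?_⟩
    · rintro _ ⟨u, hu, rfl⟩ _ ⟨v, hv, rfl⟩ huv
      obtain ⟨-, h | h⟩ := h hu hv (ne_of_apply_ne _ huv)
      exacts [h, hsymm.symm _ _ h]
    · rintro _ ⟨u, -, rfl⟩ -
      simpa using hF _ u.2
  · rintro ⟨h, -⟩ u hu v hv huv
    exact ⟨huv, Or.inl (h ⟨u, hu, rfl⟩ ⟨v, hv, rfl⟩ (Subtype.val_injective.ne huv))⟩

theorem isIndep_cayley_iff {D : Set G} (hD : ∀ x ∈ D, x⁻¹ ∈ D) (s : Set G) :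
    IsIndep (cayley G (D \ {1})) s ↔ s.Pairwise fun u v => u * v⁻¹ ∈ Set.univ \ D := by
  constructor
  · intro h u hu v hv huv
    refine ⟨trivial, fun hmem => h u hu v hv ⟨huv, Or.inl ⟨hmem, ?_⟩⟩⟩
    simpa [mul_inv_eq_one] using huv
  · rintro h u hu v hv ⟨huv, hmem | hmem⟩
    · exact (h hu hv huv).2 hmem.1
    · exact (h hu hv huv).2 (by simpa using hD _ hmem.1)

theorem isIndep_cayley_image_mul_right {D : Set G} (hD : ∀ x ∈ D, x⁻¹ ∈ D) {s : Set G}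
    (hs : IsIndep (cayley G (D \ {1})) s) (g : G) :
    IsIndep (cayley G (D \ {1})) ((· * g) '' s) := by
  rw [isIndep_cayley_iff hD] at hs ⊢
  rintro _ ⟨u, hu, rfl⟩ _ ⟨v, hv, rfl⟩ huv
  simpa [mul_assoc] using hs hu hv (ne_of_apply_ne (· * g) huv)

theorem isMaxIndep_cayley_image_mul_right {D : Set G} (hD : ∀ x ∈ D, x⁻¹ ∈ D) {s : Set G}
    (hs : IsMaxIndep (cayley G (D \ {1})) s) (g : G) :
    IsMaxIndep (cayley G (D \ {1})) ((· * g) '' s) := by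
  refine ⟨isIndep_cayley_image_mul_right hD hs.1 g, fun t ht hst => ?_⟩
  rw [← hs.2 _ (isIndep_cayley_image_mul_right hD ht g⁻¹)
    fun x hx => ⟨x * g, hst ⟨x, hx, rfl⟩, by simp⟩, Set.image_image]
  simp

theorem isMaxClique_delta_iff {D : Set G} (hD : ∀ x ∈ D, x⁻¹ ∈ D) (h1 : (1 : G) ∈ D)
    (Q : Set ↥(Set.univ \ D)) :
    IsMaxClique (delta (Set.univ \ D)) Q ↔
      IsMaxIndep (cayley G (D \ {1})) (insertOne Q) := by
  have hF : ∀ x ∈ Set.univ \ D, x⁻¹ ∈ Set.univ \ D :=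
    fun x hx => ⟨trivial, fun h => hx.2 (by simpa using hD _ h)⟩
  have h1F : (1 : G) ∉ Set.univ \ D := fun h => h.2 h1
  simp only [IsMaxClique, IsMaxIndep, isClique_delta_iff hF, isIndep_cayley_iff hD]
  refine and_congr_right fun _ => ⟨fun h t ht hQt => ?_, fun h P hP hQP => ?_⟩
  · have h1t : (1 : G) ∈ t := hQt (Set.mem_insert _ _)
    have ht' := insertOne_preimage_val h1t ht
    rw [← ht', h (Subtype.val ⁻¹' t) (by rwa [ht'])]
    rw [← preimage_val_insertOne h1F Q]
    exact Set.preimage_mono hQt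
  · rw [← preimage_val_insertOne h1F P, h _ hP (insertOne_mono hQP), preimage_val_insertOne h1F]

theorem exists_isMaxClique_delta_of_isMaxIndep_cayley {D : Set G} (hD : ∀ x ∈ D, x⁻¹ ∈ D)
    (h1 : (1 : G) ∈ D) {s : Set G} (hs : IsMaxIndep (cayley G (D \ {1})) s) :
    ∃ Q : Set ↥(Set.univ \ D), IsMaxClique (delta (Set.univ \ D)) Q ∧
      Cardinal.mk s = Cardinal.mk Q + 1 := by
  obtain ⟨g, hg⟩ : s.Nonempty := by
    by_contra! h
    subst h
    have h0 := hs.2 {1} ((isIndep_cayley_iff hD _).2 (Set.pairwise_singleton _ _))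
      (Set.empty_subset _)
    exact Set.singleton_ne_empty _ h0
  have ht := isMaxIndep_cayley_image_mul_right hD hs g⁻¹
  have h1s : (1 : G) ∈ (· * g⁻¹) '' s := ⟨g, hg, by simp⟩
  have hQ := insertOne_preimage_val h1s ((isIndep_cayley_iff hD _).1 ht.1)
  refine ⟨_, (isMaxClique_delta_iff hD h1 _).2 (hQ.symm ▸ ht), ?_⟩
  rw [← mk_insertOne fun h => h.2 h1, hQ, Cardinal.mk_image_eq (mul_left_injective g⁻¹)]

end DeltaCliques

/-- If `1 ∈ A` and `F = G \ A⁻¹A` is finite, then `Cay(G, ∂A)` is well-covered iff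
all maximal cliques of `Δ(F)` have the same cardinality. -/
theorem wellCovered_iff_delta_cliques (G : Type*) [Group G] (A : Set G)
    (h1 : (1 : G) ∈ A) (hF : (Set.univ \ (A⁻¹ * A) : Set G).Finite) :
    WellCovered (cayley G ((A⁻¹ * A) \ {1})) ↔
      ∀ Q₁ Q₂ : Set ↥(Set.univ \ (A⁻¹ * A) : Set G),
        IsMaxClique (delta (Set.univ \ (A⁻¹ * A) : Set G)) Q₁ →
        IsMaxClique (delta (Set.univ \ (A⁻¹ * A) : Set G)) Q₂ →
        Cardinal.mk Q₁ = Cardinal.mk Q₂ := by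
  have hD : ∀ x ∈ A⁻¹ * A, x⁻¹ ∈ A⁻¹ * A := by
    rintro _ ⟨a, ha, b, hb, rfl⟩
    exact ⟨b⁻¹, Set.inv_mem_inv.2 hb, a⁻¹, ha, by simp⟩
  have h1D : (1 : G) ∈ A⁻¹ * A := ⟨1, by simpa using h1, 1, h1, by simp⟩
  constructor
  · intro h Q₁ Q₂ h₁ h₂
    have h₁₂ := h _ _ ((isMaxClique_delta_iff hD h1D _).1 h₁)
      ((isMaxClique_delta_iff hD h1D _).1 h₂)
    rwa [mk_insertOne fun h => h.2 h1D, mk_insertOne fun h => h.2 h1D,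
      Cardinal.add_one_inj] at h₁₂
  · intro h s t hs ht
    obtain ⟨Q₁, hQ₁, hs'⟩ := exists_isMaxClique_delta_of_isMaxIndep_cayley hD h1D hs
    obtain ⟨Q₂, hQ₂, ht'⟩ := exists_isMaxClique_delta_of_isMaxIndep_cayley hD h1D ht
    rw [hs', ht', h Q₁ Q₂ hQ₁ hQ₂]
end

section
/- Let G be an infinite group and let F be a finite subset of G with F⁻¹ = F and 1 ∉ F. Then there exists a subset A ⊆ G with 1 ∈ A such that A⁻¹A = G \ F. -/
open Pointwise

open Cardinal in
/-- If `S` has fewer elements than the infinite group `G` and `F` is finite, then some pair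
`x, x * g` avoids `S * F`. -/
theorem exists_pair_notMem_mul {G : Type*} [Group G] [Infinite G] {S F : Set G}
    (hS : #S < #G) (hF : F.Finite) (g : G) : ∃ x, x ∉ S * F ∧ x * g ∉ S * F := by
  have hG : ℵ₀ ≤ #G := aleph0_le_mk G
  have hSF : #(S * F : Set G) < #G :=
    mk_mul_le.trans_lt (mul_lt_of_lt hG hS (hF.lt_aleph0.trans_le hG))
  have hpre : #((fun x => x * g) ⁻¹' (S * F) : Set G) < #G :=
    (mk_preimage_of_injective _ _ (mul_left_injective g)).trans_lt hSF
  by_contra! hcon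
  have huniv : (Set.univ : Set G) ⊆ S * F ∪ (fun x => x * g) ⁻¹' (S * F) := fun x _ =>
    or_iff_not_imp_left.2 (hcon x)
  exact (((mk_univ (α := G)).symm.le.trans (mk_le_mk_of_subset huniv)).trans
    (mk_union_le _ _)).not_gt (add_lt_of_lt hG hSF hpre)

open Cardinal in
/-- Along a well-order of the infinite group `G`, one can choose pairs `f i, f i * e i`, with `e i`
ranging over `G`, each avoiding the translates by the finite set `F` of `1` and of the
preceding pairs. -/
theorem exists_wellOrder_pairs.{u} {G : Type u} [Group G] [Infinite G] {F : Set G} (hF : F.Finite) :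
    ∃ (I : Type u) (_ : LinearOrder I) (e : I ≃ G) (f : I → G), ∀ i,
      ∀ y ∈ ({f i, f i * e i} : Set G), y ∉ F ∧
        ∀ j < i, ∀ z ∈ ({f j, f j * e j} : Set G), z⁻¹ * y ∉ F := by
  have hG : ℵ₀ ≤ #G := aleph0_le_mk G
  obtain ⟨e⟩ : Nonempty ((#G).ord.ToType ≃ G) := Cardinal.eq.1 (mk_ord_toType _)
  let S (i : (#G).ord.ToType) (ih : ∀ j, j < i → G) : Set G :=
    insert 1 (Set.range (fun j : Set.Iio i => ih j j.2) ∪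
      Set.range (fun j : Set.Iio i => ih j j.2 * e j))
  have hS (i) (ih : ∀ j, j < i → G) : #(S i ih) < #G := by
    have hi : #(Set.Iio i) < #G := by
      simpa using mk_Iio_lt i (by simp)
    exact mk_insert_le.trans_lt (add_lt_of_lt hG ((mk_union_le _ _).trans_lt
      (add_lt_of_lt hG (mk_range_le.trans_lt hi) (mk_range_le.trans_lt hi)))
      (one_lt_aleph0.trans_le hG))
  choose x hx hx' using fun i ih => exists_pair_notMem_mul (hS i ih) hF (e i)
  let f : (#G).ord.ToType → G := (wellFounded_lt (α := (#G).ord.ToType)).fix x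
  have hf (i) : f i = x i fun j _ => f j := WellFounded.fix_eq _ _ _
  refine ⟨_, inferInstance, e, f, fun i y hy => ?_⟩
  have hyS : y ∉ S i (fun j _ => f j) * F := by
    rcases hy with rfl | rfl
    · rw [hf i]; exact hx i fun j _ => f j
    · rw [hf i]; exact hx' i fun j _ => f j
  refine ⟨fun h => hyS ⟨1, Or.inl rfl, y, h, one_mul y⟩, fun j hj z hz h => hyS ?_⟩
  refine ⟨z, Or.inr ?_, _, h, mul_inv_cancel_left z y⟩
  rcases hz with rfl | rfl
  · exact Or.inl ⟨⟨j, hj⟩, rfl⟩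
  · exact Or.inr ⟨⟨j, hj⟩, rfl⟩

/-- For every finite symmetric `F` not containing `1` in an infinite group `G`,
there is a subset `A` with `1 ∈ A` and `A⁻¹A = G \ F`. -/
theorem exists_A_with_complement (G : Type*) [Group G] [Infinite G] (F : Set G)
    (hfin : F.Finite) (hsym : F⁻¹ = F) (h1 : (1 : G) ∉ F) :
    ∃ A : Set G, (1 : G) ∈ A ∧ A⁻¹ * A = Set.univ \ F := by
  have hinv {x : G} : x⁻¹ ∈ F ↔ x ∈ F := by rw [← Set.mem_inv, hsym]
  obtain ⟨I, _, e, f, hf⟩ := exists_wellOrder_pairs hfin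
  refine ⟨insert 1 {y | ∃ i, e i ∉ F ∧ y ∈ ({f i, f i * e i} : Set G)}, Or.inl rfl, ?_⟩
  ext g
  simp only [Set.mem_sdiff, Set.mem_univ, true_and]
  constructor
  · rintro ⟨a, ha, b, hb, rfl⟩
    obtain ⟨a, rfl⟩ := inv_surjective a
    rw [Set.inv_mem_inv] at ha
    rcases ha with rfl | ⟨i, hi, ha⟩ <;> rcases hb with rfl | ⟨j, hj, hb⟩
    · simpa using h1
    · simpa using (hf j b hb).1
    · simpa [hinv] using (hf i a ha).1
    · rcases lt_trichotomy i j with hij | rfl | hij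
      · exact (hf j b hb).2 i hij a ha
      · rcases ha with rfl | rfl <;> rcases hb with rfl | rfl <;> simpa [hinv]
      · have := (hf i a ha).2 j hij b hb
        rwa [← hinv, mul_inv_rev, inv_inv] at this
  · intro hg
    have hg' : e (e.symm g) ∉ F := by simpa
    refine ⟨(f (e.symm g))⁻¹, Set.inv_mem_inv.2 (Or.inr ⟨_, hg', Or.inl rfl⟩), _,
      Or.inr ⟨_, hg', Or.inr rfl⟩, by simp⟩
end

section
/- Let G be a group, H ≤ G a finite subgroup with |H| > 2, and f ∈ G \ H with f² ∉ H and f³ ≠ 1. Set F = {f, f⁻¹} ∪ (H \ {1}). Then F is symmetric with 1 ∉ F, the vertex f is isolated in Δ(F) (so {f} is a maximal clique of size 1), and H \ {1} is a clique of Δ(F) of size |H| − 1 ≥ 2. -/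
open Pointwise

/-- If `f ∉ H`, `f ^ 2 ∉ H` and `f ^ 3 ≠ 1`, then no `v ≠ f` in `{f, f⁻¹} ∪ (H \ {1})`
is such that `f * v⁻¹` lies in this set again. -/
theorem mul_inv_notMem_of_noncube {G : Type*} [Group G] {H : Subgroup G} {f : G}
    (hf : f ∉ H) (hf2 : f ^ 2 ∉ H) (hf3 : f ^ 3 ≠ 1) {v : G}
    (hv : v ∈ ({f, f⁻¹} ∪ ((H : Set G) \ {1}) : Set G)) (hvf : v ≠ f) :
    f * v⁻¹ ∉ ({f, f⁻¹} ∪ ((H : Set G) \ {1}) : Set G) := by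
  rintro ((h | h) | ⟨h, -⟩) <;> rcases hv with (rfl | rfl) | ⟨hvH, hv1⟩
  · exact hvf rfl
  · rw [inv_inv, mul_eq_left] at h
    exact hf (h ▸ H.one_mem)
  · exact hv1 (by simpa using h)
  · exact hvf rfl
  · refine hf3 ?_
    rw [inv_inv] at h
    rw [pow_succ, pow_two, h, inv_mul_cancel]
  · refine hf2 ?_
    have hv' : v = f ^ 2 := by
      rw [pow_two, mul_inv_eq_iff_eq_mul.mp h]
      nth_rewrite 2 [mul_inv_eq_iff_eq_mul.mp h]
      group
    exact hv' ▸ hvH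
  · exact hvf rfl
  · exact hf2 (by simpa [pow_two] using h)
  · exact hf ((H.mul_mem_cancel_right (H.inv_mem hvH)).mp h)

/-- Configuration (b): `H` finite with `|H| > 2`, `f ∉ H` with `f² ∉ H` and
`f³ ≠ 1`, `F = {f, f⁻¹} ∪ H*`. Then `f` is an isolated vertex of `Δ(F)` (so `{f}`
is a maximal clique of size 1) and `H*` is a clique of size `|H| - 1 ≥ 2`. -/
theorem config_noncube (G : Type*) [Group G] (H : Subgroup G)
    (hfin : (H : Set G).Finite) (hcard : 2 < Nat.card H)
    (f : G) (hf : f ∉ H) (hf2 : f ^ 2 ∉ H) (hf3 : f ^ 3 ≠ 1)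
    (F : Set G) (hF : F = {f, f⁻¹} ∪ ((H : Set G) \ {1})) :
    F⁻¹ = F ∧ (1 : G) ∉ F ∧
    ∃ hfF : f ∈ F,
      (∀ v : F, ¬ (delta F).Adj ⟨f, hfF⟩ v) ∧
      IsMaxClique (delta F) {(⟨f, hfF⟩ : F)} ∧
      (delta F).IsClique {x : F | (x : G) ∈ H ∧ (x : G) ≠ 1} ∧
      Set.ncard {x : F | (x : G) ∈ H ∧ (x : G) ≠ 1} = Nat.card H - 1 ∧
      2 ≤ Nat.card H - 1 := by
  have hsymm : F⁻¹ = F := by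
    subst hF
    ext x
    simp [inv_eq_iff_eq_inv, or_comm]
  have hone : (1 : G) ∉ F := by
    subst hF
    have h1 : (1 : G) ≠ f := fun h => hf (h ▸ H.one_mem)
    have h2 : (1 : G) ≠ f⁻¹ := fun h => h1 (by simpa [eq_comm] using h)
    simp [h1, h2]
  have hfF : f ∈ F := by simp [hF]
  have hiso : ∀ v : F, ¬ (delta F).Adj ⟨f, hfF⟩ v := by
    rintro ⟨v, hv⟩ hadj
    obtain ⟨hne, hadj⟩ := (SimpleGraph.fromRel_adj _ _ _).mp hadj
    have hvf : v ≠ f := fun h => hne (Subtype.ext h.symm)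
    have hmem : f * v⁻¹ ∈ F := by
      rcases hadj with h | h
      · exact h
      · rw [← hsymm, Set.mem_inv]
        simpa using h
    exact mul_inv_notMem_of_noncube hf hf2 hf3 (hF ▸ hv) hvf (hF ▸ hmem)
  refine ⟨hsymm, hone, hfF, hiso, ⟨?_, ?_⟩, ?_, ?_, by omega⟩
  · exact SimpleGraph.isClique_singleton _
  · intro t ht hst
    refine Set.Subset.antisymm (fun v hv => ?_) hst
    by_contra hne
    exact hiso v (ht (hst rfl) hv (Ne.symm hne))
  · rintro ⟨u, hu⟩ ⟨huH, -⟩ ⟨v, hv⟩ ⟨hvH, -⟩ hne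
    refine (SimpleGraph.fromRel_adj _ _ _).mpr ⟨hne, Or.inl ?_⟩
    exact hF.ge <| Or.inr ⟨H.mul_mem huH (H.inv_mem hvH),
      fun h => hne (Subtype.ext (mul_inv_eq_one.mp h))⟩
  · have himage : Subtype.val '' {x : F | (x : G) ∈ H ∧ (x : G) ≠ 1} = (H : Set G) \ {1} := by
      ext x
      constructor
      · rintro ⟨y, hy, rfl⟩
        exact hy
      · intro hx
        exact ⟨⟨x, hF ▸ Or.inr hx⟩, hx, rfl⟩
    rw [← Set.ncard_image_of_injective _ Subtype.val_injective, himage,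
      Set.ncard_sdiff_singleton_of_mem H.one_mem]
    rfl
end

section
/- Let G be a group, H ≤ G a finite subgroup with |H| > 3, and f ∈ G \ H with f³ = 1. Set F = {f, f⁻¹} ∪ (H \ {1}). Then F is symmetric with 1 ∉ F, the set {f, f⁻¹} is a maximal clique of Δ(F) of size 2, every vertex of Δ(F) has at least one neighbor (so Δ(F) has no isolated vertex), and H \ {1} is a clique of Δ(F) of size |H| − 1 > 2. -/
open Pointwise

/-- Configuration (c): `H` finite with `|H| > 3`, `f ∉ H` with `f³ = 1`,
`F = {f, f⁻¹} ∪ H*`. Then `{f, f⁻¹}` is a maximal clique of `Δ(F)` of size 2,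
`Δ(F)` has no isolated vertex, and `H*` is a clique of size `|H| - 1 > 2`. -/
theorem config_cube (G : Type*) [Group G] (H : Subgroup G)
    (hfin : (H : Set G).Finite) (hcard : 3 < Nat.card H)
    (f : G) (hf : f ∉ H) (hf3 : f ^ 3 = 1)
    (F : Set G) (hF : F = {f, f⁻¹} ∪ ((H : Set G) \ {1})) :
    F⁻¹ = F ∧ (1 : G) ∉ F ∧
    IsMaxClique (delta F) {x : F | (x : G) = f ∨ (x : G) = f⁻¹} ∧
    Set.ncard {x : F | (x : G) = f ∨ (x : G) = f⁻¹} = 2 ∧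
    (∀ u : F, ∃ v : F, (delta F).Adj u v) ∧
    (delta F).IsClique {x : F | (x : G) ∈ H ∧ (x : G) ≠ 1} ∧
    Set.ncard {x : F | (x : G) ∈ H ∧ (x : G) ≠ 1} = Nat.card H - 1 ∧
    2 < Nat.card H - 1 := by
  have hf1 : f ≠ 1 := fun h => hf (h ▸ H.one_mem)
  have hff : f * f = f⁻¹ := by
    rw [eq_inv_iff_mul_eq_one, ← hf3, pow_succ, pow_two]
  have hfi : f⁻¹ * f⁻¹ = f := by rw [← mul_inv_rev, hff, inv_inv]
  have hne : f ≠ f⁻¹ := by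
    intro h
    apply hf1
    rw [← hff] at h
    exact left_eq_mul.mp h
  have hf' : f⁻¹ ∉ H := fun h => hf (by simpa using H.inv_mem h)
  have hmem : ∀ x, x ∈ F ↔ (x = f ∨ x = f⁻¹) ∨ (x ∈ H ∧ x ≠ 1) := by
    intro x
    simp [hF]
  have hfF : f ∈ F := (hmem f).2 (Or.inl (Or.inl rfl))
  have hfiF : f⁻¹ ∈ F := (hmem _).2 (Or.inl (Or.inr rfl))
  have hadj : ∀ u v : F, (delta F).Adj u v ↔
      u ≠ v ∧ ((u : G) * (v : G)⁻¹ ∈ F ∨ (v : G) * (u : G)⁻¹ ∈ F) := fun u v =>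
    SimpleGraph.fromRel_adj _ u v
  have hHadj : ∀ u v : F, (u : G) ∈ H → (v : G) ∈ H → u ≠ v → (delta F).Adj u v := by
    intro u v hu hv huv
    refine (hadj u v).2 ⟨huv, Or.inl ((hmem _).2 (Or.inr ⟨H.mul_mem hu (H.inv_mem hv), ?_⟩))⟩
    rw [Ne, mul_inv_eq_one]
    exact fun h => huv (Subtype.ext h)
  have hffadj : (delta F).Adj ⟨f, hfF⟩ ⟨f⁻¹, hfiF⟩ := by
    refine (hadj _ _).2 ⟨fun h => hne (congrArg Subtype.val h), Or.inl ?_⟩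
    simpa [hff] using hfiF
  have hnadj : ∀ u : F, (u : G) ∈ H → ¬ (delta F).Adj u ⟨f, hfF⟩ := by
    rintro ⟨h, hhF⟩ hh hA
    have hh : h ∈ H := hh
    have h1 : h ≠ 1 := by
      rcases (hmem h).1 hhF with (rfl | rfl) | h'
      exacts [hf1, fun e => hf' (e ▸ hh), h'.2]
    have key : f * h⁻¹ ∉ F := by
      intro hm
      rcases (hmem _).1 hm with (e | e) | e
      · exact h1 (by simpa using e)
      · rw [← hff, mul_right_inj] at e
        exact hf (e ▸ H.inv_mem hh)
      · exact hf ((H.mul_mem_cancel_right (H.inv_mem hh)).1 e.1)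
    have key' : h * f⁻¹ ∉ F := by
      intro hm
      rcases (hmem _).1 hm with (e | e) | e
      · rw [mul_inv_eq_iff_eq_mul, hff] at e
        exact hf' (e ▸ hh)
      · exact h1 (by simpa using e)
      · exact hf' ((H.mul_mem_cancel_left hh).1 e.1)
    exact ((hadj _ _).1 hA).2.elim key' key
  have hcardH : Set.ncard ((H : Set G) \ {1}) = Nat.card H - 1 := by
    rw [Set.ncard_sdiff_singleton_of_mem H.one_mem]
    rfl
  have himg : Set.ncard {x : F | (x : G) ∈ H ∧ (x : G) ≠ 1} = Nat.card H - 1 := by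
    rw [← hcardH, ← Set.ncard_image_of_injective _ Subtype.val_injective]
    congr 1
    ext x
    simp [hmem]
    tauto
  have hpair : {x : F | (x : G) = f ∨ (x : G) = f⁻¹} = {⟨f, hfF⟩, ⟨f⁻¹, hfiF⟩} := by
    ext x
    simp [Subtype.ext_iff]
  refine ⟨?_, ?_, ⟨?_, ?_⟩, ?_, ?_, ?_, himg, by omega⟩
  · ext x
    simp only [Set.mem_inv, hmem, inv_eq_iff_eq_inv, inv_inv, inv_mem_iff, ne_eq, inv_one]
    tauto
  · rw [hmem]
    rintro ((e | e) | e)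
    · exact hf1 e.symm
    · exact hf1 (by simpa using e.symm)
    · exact e.2 rfl
  · rw [hpair, SimpleGraph.isClique_pair]
    exact fun _ => hffadj
  · intro t ht hst
    refine Set.Subset.antisymm (fun x hx => ?_) hst
    rcases (hmem x).1 x.2 with h | h
    · exact h
    · refine absurd (ht hx (hst (Or.inl rfl : (⟨f, hfF⟩ : F) ∈ _)) ?_) (hnadj x h.1)
      exact fun e => hf (by simpa [e] using h.1)
  · rw [hpair, Set.ncard_pair hffadj.ne]
  · rintro ⟨u, hu⟩
    rcases (hmem u).1 hu with (rfl | rfl) | h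
    · exact ⟨_, hffadj⟩
    · exact ⟨_, hffadj.symm⟩
    · obtain ⟨v, hv, hvu⟩ := Set.exists_ne_of_one_lt_ncard
        (show 1 < Set.ncard {x : F | (x : G) ∈ H ∧ (x : G) ≠ 1} by omega) ⟨u, hu⟩
      exact ⟨v, hHadj _ _ h.1 hv.1 hvu.symm⟩
  · exact fun u hu v hv huv => hHadj u v hu.1 hv.1 huv
end

section
/- Let G be a group and s ∈ G an element of infinite order. Let n > 2 and m ≥ 2n + 1 be integers, and set F = {s^m, s^{−m}} ∪ {s^i : 1 ≤ |i| ≤ n}. Then F is symmetric with 1 ∉ F, the vertex s^m is isolated in Δ(F) (so {s^m} is a maximal clique of size 1), and {s, s², …, s^{n−1}} is a clique of Δ(F) of size n − 1 ≥ 2. -/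
open Pointwise

theorem zpow_injective_of_infinite_order {G : Type*} [Group G] {s : G}
    (hs : ∀ k : ℤ, k ≠ 0 → s ^ k ≠ 1) : Function.Injective fun k : ℤ => s ^ k := by
  intro a b hab
  by_contra hne
  exact hs (a - b) (sub_ne_zero.mpr hne) (by rw [zpow_sub, mul_inv_eq_one]; exact hab)

theorem isMaxClique_singleton_of_isolated {V : Type*} {Γ : SimpleGraph V} {v : V}
    (hv : ∀ w, ¬ Γ.Adj v w) : IsMaxClique Γ {v} := by
  refine ⟨by simp, fun t ht hvt => hvt.antisymm' fun w hw => ?_⟩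
  by_contra hne
  exact hv w (ht (hvt rfl) hw (Ne.symm hne))

/-- Configuration (d): `s` of infinite order, `n > 2`, `m ≥ 2n + 1`, and
`F = {s^m, s^{-m}} ∪ {s^i : 1 ≤ |i| ≤ n}`. Then `s^m` is an isolated vertex of
`Δ(F)` (so `{s^m}` is a maximal clique of size 1) and `{s, s², …, s^{n-1}}` is a
clique of size `n - 1 ≥ 2`. -/
theorem config_infinite_order (G : Type*) [Group G] (s : G)
    (hs : ∀ k : ℤ, k ≠ 0 → s ^ k ≠ 1)
    (n m : ℕ) (hn : 2 < n) (hm : 2 * n + 1 ≤ m)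
    (F : Set G)
    (hF : F = {s ^ (m : ℤ), s ^ (-(m : ℤ))} ∪
      {x : G | ∃ i : ℤ, 1 ≤ |i| ∧ |i| ≤ (n : ℤ) ∧ x = s ^ i}) :
    F⁻¹ = F ∧ (1 : G) ∉ F ∧
    ∃ hsm : s ^ (m : ℤ) ∈ F,
      (∀ v : F, ¬ (delta F).Adj ⟨s ^ (m : ℤ), hsm⟩ v) ∧
      IsMaxClique (delta F) {(⟨s ^ (m : ℤ), hsm⟩ : F)} ∧
      (delta F).IsClique {x : F | ∃ i : ℤ, 1 ≤ i ∧ i ≤ (n : ℤ) - 1 ∧ (x : G) = s ^ i} ∧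
      Set.ncard {x : F | ∃ i : ℤ, 1 ≤ i ∧ i ≤ (n : ℤ) - 1 ∧ (x : G) = s ^ i} = n - 1 ∧
      2 ≤ n - 1 := by
  have hinj := zpow_injective_of_infinite_order hs
  have hmem : ∀ k : ℤ, s ^ k ∈ F ↔ k = m ∨ k = -m ∨ (1 ≤ |k| ∧ |k| ≤ n) := by
    intro k
    rw [hF]
    constructor
    · rintro ((h | h) | ⟨i, h1, h2, h⟩)
      · exact Or.inl (hinj h)
      · exact Or.inr (Or.inl (hinj h))
      · obtain rfl : k = i := hinj h
        exact Or.inr (Or.inr ⟨h1, h2⟩)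
    · rintro (rfl | rfl | ⟨h1, h2⟩)
      · exact Or.inl (Or.inl rfl)
      · exact Or.inl (Or.inr rfl)
      · exact Or.inr ⟨k, h1, h2, rfl⟩
  have hexp : ∀ x ∈ F, ∃ k : ℤ, x = s ^ k := by
    intro x hx
    rw [hF] at hx
    rcases hx with (h | h) | ⟨i, _, _, h⟩
    exacts [⟨_, h⟩, ⟨_, h⟩, ⟨i, h⟩]
  have hinv : ∀ x ∈ F, x⁻¹ ∈ F := by
    intro x hx
    obtain ⟨k, rfl⟩ := hexp x hx
    rw [hmem] at hx
    rw [← zpow_neg, hmem, abs_neg]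
    omega
  have hsm : s ^ (m : ℤ) ∈ F := (hmem _).2 (Or.inl rfl)
  have hisolated : ∀ v : F, ¬ (delta F).Adj ⟨s ^ (m : ℤ), hsm⟩ v := by
    rintro ⟨v, hv⟩ hadj
    obtain ⟨k, rfl⟩ := hexp v hv
    rw [delta, SimpleGraph.fromRel_adj] at hadj
    obtain ⟨hne, hadj⟩ := hadj
    have hkm : k ≠ m := by
      rintro rfl
      exact hne rfl
    simp only [← zpow_sub] at hadj
    rw [hmem, hmem] at hadj
    rw [hmem] at hv
    clear * - hm hkm hadj hv
    grind
  refine ⟨?_, ?_, hsm, hisolated, isMaxClique_singleton_of_isolated hisolated, ?_, ?_, by omega⟩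
  · ext x
    exact ⟨fun hx => inv_inv x ▸ hinv _ hx, hinv x⟩
  · rw [← zpow_zero s, hmem]
    simp
    omega
  · rintro ⟨x, hx⟩ ⟨i, hi1, hi2, rfl⟩ ⟨y, hy⟩ ⟨j, hj1, hj2, rfl⟩ hne
    rw [delta, SimpleGraph.fromRel_adj]
    refine ⟨hne, Or.inl ?_⟩
    have hij : i ≠ j := by
      rintro rfl
      exact hne rfl
    simp only [← zpow_sub]
    rw [hmem]
    clear * - hi1 hi2 hj1 hj2 hij
    grind
  · rw [← Set.ncard_image_of_injective _ Subtype.val_injective]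
    have himage : Subtype.val '' {x : F | ∃ i : ℤ, 1 ≤ i ∧ i ≤ (n : ℤ) - 1 ∧ (x : G) = s ^ i} =
        (fun k : ℤ => s ^ k) '' (Finset.Icc 1 ((n : ℤ) - 1) : Finset ℤ) := by
      ext x
      constructor
      · rintro ⟨y, ⟨i, h1, h2, h⟩, rfl⟩
        exact ⟨i, by simp [h1]; omega, h.symm⟩
      · rintro ⟨i, hi, rfl⟩
        rw [Finset.mem_coe, Finset.mem_Icc] at hi
        exact ⟨⟨s ^ i, (hmem i).2 (by grind)⟩, ⟨i, hi.1, hi.2, rfl⟩, rfl⟩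
    rw [himage, Set.ncard_image_of_injective _ hinj, Set.ncard_coe_finset, Int.card_Icc]
    omega
end

section
/- Let G be a group in which every element has order a power of 2, let h ∈ G be an element of order 4, and let H = ⟨h⟩ be the cyclic subgroup it generates. If g² ∈ {h, h², h³} for every g ∈ G \ H, then G is finite. -/
/-- If a set `s` contains the product of any two elements of `t` outside `s`, then finiteness of
`s` implies finiteness of `t`. -/
theorem Set.Finite.of_mul_mem_of_notMem {G : Type*} [Group G] {s t : Set G} (hs : s.Finite)
    (hmul : ∀ a ∈ t, ∀ b ∈ t, a ∉ s → b ∉ s → a * b ∈ s) : t.Finite := by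
  by_cases hts : t ⊆ s
  · exact hs.subset hts
  · obtain ⟨a, hat, has⟩ := Set.not_subset.mp hts
    refine (hs.union (hs.image (a⁻¹ * ·))).subset fun b hbt => ?_
    by_cases hbs : b ∈ s
    · exact Or.inl hbs
    · exact Or.inr ⟨a * b, hmul a hat b hbt has hbs, inv_mul_cancel_left a b⟩

section SquaresInCyclicFour

variable {G : Type*} [Group G] {h : G}

/-- If every square outside `⟨h⟩` lies in `{h, h², h³}`, every element centralizes or inverts
`h`. -/
theorem commute_or_semiconjBy_inv_of_sq_mem (hh : orderOf h = 4)
    (hsq : ∀ g : G, g ∉ Subgroup.zpowers h → g ^ 2 ∈ ({h, h ^ 2, h ^ 3} : Set G)) (g : G) :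
    Commute g h ∨ SemiconjBy g h h⁻¹ := by
  have h4 : h ^ 4 = 1 := hh ▸ pow_orderOf_eq_one h
  have key : ∀ x : G, Commute x h ∨ x ^ 2 = h ^ 2 := by
    intro x
    by_cases hx : x ∈ Subgroup.zpowers h
    · obtain ⟨n, rfl⟩ := hx
      exact Or.inl ((Commute.refl h).zpow_left n)
    · rcases hsq x hx with e | e | e
      · exact Or.inl (e ▸ Commute.self_pow x 2)
      · exact Or.inr e
      · have e' : h = (x ^ 2) ^ 3 := by
          rw [e, ← pow_mul, show 3 * 3 = 4 + 4 + 1 from rfl, pow_succ, pow_add, h4]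
          simp
        left
        rw [e', ← pow_mul]
        exact Commute.self_pow x _
  rcases key g with hg | hg
  · exact Or.inl hg
  rcases key (g * h) with hgh | hgh
  · left
    simpa using hgh.mul_left (Commute.refl h).inv_left
  · right
    have e : g * (h * g * h) = g * g := by
      rw [← pow_two g, hg, ← hgh, pow_two]
      group
    have e' : h * g * h = g := mul_left_cancel e
    rw [SemiconjBy, eq_inv_mul_iff_mul_eq, ← mul_assoc, e']

/-- If every square outside `⟨h⟩` lies in `{h, h², h³}`, the elements of the centralizer of `h`
outside `⟨h⟩` have odd powers of `h` as squares. -/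
theorem exists_sq_eq_zpow_odd_of_commute (hh : orderOf h = 4)
    (hsq : ∀ g : G, g ∉ Subgroup.zpowers h → g ^ 2 ∈ ({h, h ^ 2, h ^ 3} : Set G))
    {c : G} (hc : Commute c h) (hcH : c ∉ Subgroup.zpowers h) :
    ∃ n : ℤ, Odd n ∧ c ^ 2 = h ^ n := by
  have h4 : h ^ 4 = 1 := hh ▸ pow_orderOf_eq_one h
  rcases hsq c hcH with e | e | e
  · exact ⟨1, by decide, by simpa using e⟩
  · have hchH : c * h ∉ Subgroup.zpowers h := fun hm =>
      hcH ((Subgroup.mul_mem_cancel_right _ (Subgroup.mem_zpowers h)).mp hm)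
    have e1 : (c * h) ^ 2 = 1 := by rw [hc.mul_pow, e, ← pow_add, h4]
    have hne : ∀ k : ℕ, 0 < k → k < 4 → h ^ k ≠ 1 := fun k hk hk4 =>
      pow_ne_one_of_lt_orderOf hk.ne' (hh ▸ hk4)
    rcases hsq _ hchH with e2 | e2 | e2
    · exact absurd (by rw [pow_one, ← e2, e1]) (hne 1 (by norm_num) (by norm_num))
    · exact absurd (e2.symm.trans e1) (hne 2 (by norm_num) (by norm_num))
    · exact absurd (e2.symm.trans e1) (hne 3 (by norm_num) (by norm_num))
  · exact ⟨3, by decide, by exact_mod_cast e⟩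

/-- If every square outside `⟨h⟩` lies in `{h, h², h³}`, then `⟨h⟩` contains the product of any
two elements of the centralizer of `h` outside `⟨h⟩`. -/
theorem mul_mem_zpowers_of_commute_of_notMem (hh : orderOf h = 4)
    (hsq : ∀ g : G, g ∉ Subgroup.zpowers h → g ^ 2 ∈ ({h, h ^ 2, h ^ 3} : Set G))
    {c d : G} (hc : Commute c h) (hd : Commute d h)
    (hcH : c ∉ Subgroup.zpowers h) (hdH : d ∉ Subgroup.zpowers h) :
    c * d ∈ Subgroup.zpowers h := by
  by_contra hcd
  obtain ⟨a, ha, ea⟩ := exists_sq_eq_zpow_odd_of_commute hh hsq hc hcH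
  obtain ⟨b, hb, eb⟩ := exists_sq_eq_zpow_odd_of_commute hh hsq hd hdH
  obtain ⟨n, hn, en⟩ := exists_sq_eq_zpow_odd_of_commute hh hsq (hc.mul_left hd) hcd
  have hcz (m : ℤ) : c * h ^ m = h ^ m * c := hc.zpow_right m
  have hdz (m : ℤ) : d * h ^ m = h ^ m * d := hd.zpow_right m
  have hdc : d * c = h ^ (n - a - b) * (c * d) := by
    have e : h ^ a * (d * c) * h ^ b = h ^ n * (c * d) := by
      rw [← mul_assoc (h ^ n), ← hcz, ← en, ← ea, ← eb]
      simp only [pow_two, mul_assoc]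
    rw [mul_assoc, mul_assoc, hcz, ← mul_assoc d, hdz, ← mul_assoc, ← mul_assoc,
      ← zpow_add, mul_assoc] at e
    rw [show n - a - b = -(a + b) + n by ring, zpow_add, mul_assoc, ← e, zpow_neg,
      inv_mul_cancel_left]
  have hcomm : h ^ (2 * (n - a - b)) = 1 := by
    have e : d * c ^ 2 = h ^ (2 * (n - a - b)) * (c ^ 2 * d) := by
      rw [pow_two, ← mul_assoc, hdc, mul_assoc, mul_assoc, hdc, ← mul_assoc c, hcz,
        two_mul, zpow_add]
      simp only [mul_assoc]
    rw [ea, hdz] at e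
    exact mul_eq_right.mp e.symm
  have hdvd : (4 : ℤ) ∣ 2 * (n - a - b) := by
    exact_mod_cast hh ▸ orderOf_dvd_iff_zpow_eq_one.mpr hcomm
  obtain ⟨i, rfl⟩ := ha
  obtain ⟨j, rfl⟩ := hb
  obtain ⟨k, rfl⟩ := hn
  omega

end SquaresInCyclicFour

/-- In a 2-group (every element has 2-power order), if `h` has order 4,
`H = ⟨h⟩`, and every `g ∉ H` satisfies `g² ∈ {h, h², h³}`, then `G` is finite. -/
theorem finite_of_squares_in_cyclic_four (G : Type*) [Group G]
    (h2grp : ∀ g : G, ∃ k : ℕ, orderOf g = 2 ^ k)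
    (h : G) (hh : orderOf h = 4)
    (hsq : ∀ g : G, g ∉ Subgroup.zpowers h → g ^ 2 ∈ ({h, h ^ 2, h ^ 3} : Set G)) :
    Finite G := by
  have hH : (Subgroup.zpowers h : Set G).Finite :=
    finite_zpowers.mpr (orderOf_pos_iff.mp (by omega))
  have hC : {g : G | Commute g h}.Finite :=
    hH.of_mul_mem_of_notMem fun _ hc _ hd =>
      mul_mem_zpowers_of_commute_of_notMem hh hsq hc hd
  refine Set.finite_univ_iff.mp (hC.of_mul_mem_of_notMem fun a _ b _ ha hb => ?_)
  have ha' := (commute_or_semiconjBy_inv_of_sq_mem hh hsq a).resolve_left ha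
  have hb' := (commute_or_semiconjBy_inv_of_sq_mem hh hsq b).resolve_left hb
  have ha_inv : SemiconjBy a h⁻¹ h := by simpa using ha'.inv_right
  exact ha_inv.mul_left hb'
end

section
/- Let G be a group containing a finite subgroup H such that g² ∈ H for every g ∈ G. Then G is locally finite: every finitely generated subgroup of G is finite. -/
/-- A subgroup containing all squares is normal. -/
theorem Subgroup.normal_of_sq_mem {G : Type*} [Group G] {H : Subgroup G}
    (hsq : ∀ g : G, g ^ 2 ∈ H) : H.Normal where
  conj_mem h hh g := by
    have key : g * h * g⁻¹ = (g * h) ^ 2 * h⁻¹ * (g ^ 2)⁻¹ := by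
      simp only [pow_two]; group
    rw [key]
    exact H.mul_mem (H.mul_mem (hsq _) (H.inv_mem hh)) (H.inv_mem (hsq g))

/-- A finitely generated group in which every element squares to `1` is finite. -/
theorem Group.finite_of_fg_of_sq_eq_one {Q : Type*} [Group Q] [Group.FG Q]
    (hsq : ∀ q : Q, q ^ 2 = 1) : Finite Q := by
  let _ : CommGroup Q :=
    { mul_comm := fun a b =>
        Commute.of_orderOf_dvd_two (fun q => orderOf_dvd_of_pow_eq_one (hsq q)) a b }
  exact CommGroup.finite_of_fg_isMulTorsion Q fun q =>
    isOfFinOrder_iff_pow_eq_one.2 ⟨2, two_pos, hsq q⟩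

/-- If `G` contains a finite subgroup `H` with `g² ∈ H` for every `g ∈ G`,
then `G` is locally finite: every finitely generated subgroup of `G` is finite. -/
theorem locallyFinite_of_squares_in_finite_subgroup (G : Type*) [Group G]
    (H : Subgroup G) (hfin : (H : Set G).Finite) (hsq : ∀ g : G, g ^ 2 ∈ H) :
    ∀ K : Subgroup G, K.FG → Finite K := by
  intro K hK
  have : Group.FG K := (Group.fg_iff_subgroup_fg K).2 hK
  have : H.Normal := Subgroup.normal_of_sq_mem hsq
  have : Finite (H.subgroupOf K) :=
    (hfin.preimage Subtype.val_injective.injOn).to_subtype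
  have : Finite (K ⧸ H.subgroupOf K) := Group.finite_of_fg_of_sq_eq_one fun q => by
    induction q using QuotientGroup.induction_on with
    | H k => exact (QuotientGroup.eq_one_iff (k ^ 2)).2 (hsq k)
  exact Finite.of_equiv _ (Subgroup.groupEquivQuotientProdSubgroup (s := H.subgroupOf K)).symm
end
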